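/- arXiv:2011.06436 — 6 statements merged into one kernel-verified Lean document; each statement's English description precedes it below -/
import Mathlib

section
/- Let D be a positive definite p-by-p real matrix, B in R^p a nonzero vector, and sigma^2 > 1 a real number. Suppose the positive definite matrix Sigma satisfies Sigma = D + sigma^{-2} (B^T Sigma^{-1} B)^{-1} B B^T with B^T Sigma^{-1} B > 0. Then B^T Sigma^{-1} B = ((sigma^2 - 1)/sigma^2) * B^T D^{-1} B, and consequently Sigma = D + (sigma^2 - 1)^{-1} (B^T D^{-1} B)^{-1} B B^T. -/
open Matrix

/-- if the positive definite matrix `Σ` satisfies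
`Σ = D + σ⁻² (Bᵀ Σ⁻¹ B)⁻¹ B Bᵀ` with `D` positive definite, `B ≠ 0`,
`σ² > 1` and `Bᵀ Σ⁻¹ B > 0`, then
`Bᵀ Σ⁻¹ B = ((σ² - 1)/σ²) Bᵀ D⁻¹ B`, and consequently
`Σ = D + (σ² - 1)⁻¹ (Bᵀ D⁻¹ B)⁻¹ B Bᵀ`. -/
theorem stmt7 {p : ℕ} (D Sigma : Matrix (Fin p) (Fin p) ℝ) (hD : D.PosDef)
    (B : Fin p → ℝ) (hB : B ≠ 0) (s : ℝ) (hs : 1 < s)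
    (hSigma : Sigma.PosDef)
    (hq : 0 < B ⬝ᵥ Sigma⁻¹ *ᵥ B)
    (heq : Sigma = D + (s⁻¹ * (B ⬝ᵥ Sigma⁻¹ *ᵥ B)⁻¹) • vecMulVec B B) :
    B ⬝ᵥ Sigma⁻¹ *ᵥ B = ((s - 1) / s) * (B ⬝ᵥ D⁻¹ *ᵥ B) ∧
      Sigma = D + ((s - 1)⁻¹ * (B ⬝ᵥ D⁻¹ *ᵥ B)⁻¹) • vecMulVec B B := by
  have hs0 : s ≠ 0 := by positivity
  have hs1 : s - 1 ≠ 0 := sub_ne_zero.mpr hs.ne'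
  have hSu : IsUnit Sigma.det := (isUnit_iff_isUnit_det _).mp hSigma.isUnit
  have hDu : IsUnit D.det := (isUnit_iff_isUnit_det _).mp hD.isUnit
  have hSB : Sigma *ᵥ (Sigma⁻¹ *ᵥ B) = B := by
    rw [mulVec_mulVec, mul_nonsing_inv _ hSu, one_mulVec]
  generalize Sigma⁻¹ *ᵥ B = u at *
  have hDSB : D *ᵥ u = ((s - 1) / s) • B := by
    rw [heq, add_mulVec, smul_mulVec, vecMulVec_mulVec, op_smul_eq_smul, smul_smul,
      mul_assoc, inv_mul_cancel₀ hq.ne', mul_one] at hSB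
    rw [sub_div, div_self hs0, sub_smul, one_smul, one_div]
    exact eq_sub_of_add_eq hSB
  have hu : u = ((s - 1) / s) • D⁻¹ *ᵥ B := by
    rw [← mulVec_smul, ← hDSB, mulVec_mulVec, nonsing_inv_mul _ hDu, one_mulVec]
  have hquad : B ⬝ᵥ u = ((s - 1) / s) * (B ⬝ᵥ D⁻¹ *ᵥ B) := by
    conv_lhs => rw [hu, dotProduct_smul, smul_eq_mul]
  refine ⟨hquad, ?_⟩
  have hcoeff : s⁻¹ * (B ⬝ᵥ u)⁻¹ = (s - 1)⁻¹ * (B ⬝ᵥ D⁻¹ *ᵥ B)⁻¹ := by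
    rw [hquad, mul_inv, inv_div, div_eq_mul_inv, ← mul_assoc, ← mul_assoc,
      inv_mul_cancel₀ hs0, one_mul]
  rw [heq, hcoeff]
end

section
/- Let D be a positive definite p-by-p real matrix, v in R^p a nonzero vector, and s > 0 a real number. Set Sigma = D + s^{-1} v v^T and H = v^T D^{-1} v. If v^T Sigma^{-1} v = 1, then H > 1 and s = H / (H - 1). -/
open Matrix

/-- The Sherman–Morrison identity for the quadratic form of an inverse, in multiplied-out form. -/
theorem dotProduct_inv_mulVec_eq_of_isUnit {n K : Type*} [Fintype n] [DecidableEq n] [Field K]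
    {D : Matrix n n K} (v : n → K) (c : K) (hD : IsUnit D)
    (hS : IsUnit (D + c • vecMulVec v v)) :
    v ⬝ᵥ D⁻¹ *ᵥ v =
      (1 + c * (v ⬝ᵥ D⁻¹ *ᵥ v)) * (v ⬝ᵥ (D + c • vecMulVec v v)⁻¹ *ᵥ v) := by
  set S := D + c • vecMulVec v v with hSdef
  have hdetD := (isUnit_iff_isUnit_det D).1 hD
  have hdetS := (isUnit_iff_isUnit_det S).1 hS
  have hmul : S *ᵥ (D⁻¹ *ᵥ v) = (1 + c * (v ⬝ᵥ D⁻¹ *ᵥ v)) • v := by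
    rw [hSdef, add_mulVec, mulVec_mulVec, mul_nonsing_inv D hdetD, one_mulVec, smul_mulVec,
      vecMulVec_mulVec]
    ext i
    simp
    ring
  have hinv : D⁻¹ *ᵥ v = (1 + c * (v ⬝ᵥ D⁻¹ *ᵥ v)) • (S⁻¹ *ᵥ v) := by
    rw [← mulVec_smul, ← hmul, mulVec_mulVec, nonsing_inv_mul S hdetS, one_mulVec]
  simpa only [dotProduct_smul, smul_eq_mul] using congrArg (v ⬝ᵥ ·) hinv

/-- with `D` positive definite, `v ≠ 0`, `s > 0`,
`Σ = D + s⁻¹ v vᵀ` and `H = vᵀ D⁻¹ v`, the regression constraint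
`vᵀ Σ⁻¹ v = 1` implies `H > 1` and `s = H / (H - 1)`. -/
theorem stmt8 {p : ℕ} (D : Matrix (Fin p) (Fin p) ℝ) (hD : D.PosDef)
    (v : Fin p → ℝ) (hv : v ≠ 0) (s : ℝ) (hs : 0 < s)
    (h1 : v ⬝ᵥ (D + s⁻¹ • vecMulVec v v)⁻¹ *ᵥ v = 1) :
    1 < v ⬝ᵥ D⁻¹ *ᵥ v ∧
      s = (v ⬝ᵥ D⁻¹ *ᵥ v) / (v ⬝ᵥ D⁻¹ *ᵥ v - 1) := by
  have hH : 0 < v ⬝ᵥ D⁻¹ *ᵥ v := by simpa using hD.inv.dotProduct_mulVec_pos hv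
  have hS : IsUnit (D + s⁻¹ • vecMulVec v v) := by
    by_contra hS
    rw [isUnit_iff_isUnit_det] at hS
    simp [nonsing_inv_apply_not_isUnit _ hS] at h1
  have key := dotProduct_inv_mulVec_eq_of_isUnit v s⁻¹ hD.isUnit hS
  rw [h1] at key
  generalize v ⬝ᵥ D⁻¹ *ᵥ v = H at hH key ⊢
  have hsH : s * (H - 1) = H := by
    field_simp at key
    linarith
  have hH1 : 0 < H - 1 := pos_of_mul_pos_right (hsH.symm ▸ hH) hs.le
  exact ⟨by linarith, (eq_div_iff hH1.ne').2 hsH⟩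
end

section
/- Let D and D' be p-by-p real diagonal matrices, B in R^p a vector with at least two nonzero entries, and c, c' real numbers. If D + c * B B^T = D' + c' * B B^T, then c = c' and D = D'. -/
open Matrix

/-- if the diagonal matrices `D, D'` satisfy
`D + c B Bᵀ = D' + c' B Bᵀ` and `B` has at least two nonzero entries,
then `c = c'` and `D = D'`. -/
theorem stmt10 {p : ℕ} (D D' : Matrix (Fin p) (Fin p) ℝ)
    (hD : D.IsDiag) (hD' : D'.IsDiag) (B : Fin p → ℝ)
    (hB : ∃ i j, i ≠ j ∧ B i ≠ 0 ∧ B j ≠ 0) (c c' : ℝ)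
    (heq : D + c • vecMulVec B B = D' + c' • vecMulVec B B) :
    c = c' ∧ D = D' := by
  obtain ⟨i, j, hij, hi, hj⟩ := hB
  have hc : c = c' := by
    have h := congrFun (congrFun heq i) j
    simp only [Matrix.add_apply, Matrix.smul_apply, vecMulVec_apply, smul_eq_mul, hD hij,
      hD' hij, zero_add] at h
    exact mul_right_cancel₀ (mul_ne_zero hi hj) h
  subst hc
  exact ⟨rfl, add_right_cancel heq⟩
end

section
/- Let D be a positive semidefinite p-by-p real matrix and v in R^p a vector such that Sigma = D + v v^T is positive definite. Then v^T Sigma^{-1} v <= 1. -/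
open Matrix

/-- if `D` is positive semidefinite, `v ∈ ℝ^p` and
`Σ = D + v vᵀ` is positive definite, then `vᵀ Σ⁻¹ v ≤ 1`. -/
theorem stmt12 {p : ℕ} (D : Matrix (Fin p) (Fin p) ℝ) (hD : D.PosSemidef)
    (v : Fin p → ℝ) (hS : (D + vecMulVec v v).PosDef) :
    v ⬝ᵥ (D + vecMulVec v v)⁻¹ *ᵥ v ≤ 1 := by
  set w := (D + vecMulVec v v)⁻¹ *ᵥ v with hw
  have hSw : (D + vecMulVec v v) *ᵥ w = v := by
    rw [hw, mulVec_mulVec, mul_nonsing_inv _ ((isUnit_iff_isUnit_det _).mp hS.isUnit), one_mulVec]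
  have hDw : 0 ≤ w ⬝ᵥ D *ᵥ w := by simpa using hD.dotProduct_mulVec_nonneg w
  have hquad : w ⬝ᵥ D *ᵥ w + (v ⬝ᵥ w) * (v ⬝ᵥ w) = v ⬝ᵥ w := by
    have h := congrArg (w ⬝ᵥ ·) hSw
    simpa [add_mulVec, vecMulVec_mulVec, dotProduct_add, dotProduct_comm w v] using h
  nlinarith
end

section
/- Let D_X be a positive definite p-by-p real matrix, D_Y a positive definite r-by-r real matrix, v in R^p, u in R^r nonzero vectors, rho a real number. Set Sigma_X = D_X + v v^T, Sigma_Y = D_Y + u u^T, Sigma_{XY} = rho * (v u^T), h_X = v^T D_X^{-1} v and h_Y = u^T D_Y^{-1} u. Then (v^T Sigma_X^{-1} v)^{-1/2} (u^T Sigma_Y^{-1} u)^{-1/2} * v^T Sigma_X^{-1} Sigma_{XY} Sigma_Y^{-1} u = sqrt( (h_X/(1+h_X)) * (h_Y/(1+h_Y)) ) * rho. -/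
open Matrix

namespace Matrix

variable {m n : Type*} [Fintype m] [Fintype n]

theorem PosDef.dotProduct_inv_mulVec_nonneg [DecidableEq n] {D : Matrix n n ℝ} (hD : D.PosDef)
    (v : n → ℝ) : 0 ≤ v ⬝ᵥ D⁻¹ *ᵥ v := by
  simpa using hD.inv.posSemidef.dotProduct_mulVec_nonneg v

theorem PosDef.add_vecMulVec_self {D : Matrix n n ℝ} (hD : D.PosDef) (v : n → ℝ) :
    (D + vecMulVec v v).PosDef := by
  simpa using hD.add_posSemidef (posSemidef_vecMulVec_self_star v)

theorem PosDef.dotProduct_inv_add_vecMulVec_mulVec [DecidableEq n] {D : Matrix n n ℝ}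
    (hD : D.PosDef) (v : n → ℝ) :
    v ⬝ᵥ (D + vecMulVec v v)⁻¹ *ᵥ v = (v ⬝ᵥ D⁻¹ *ᵥ v) / (1 + v ⬝ᵥ D⁻¹ *ᵥ v) := by
  have hdet : IsUnit D.det := D.isUnit_iff_isUnit_det.mp hD.isUnit
  have hdet' : IsUnit (D + vecMulVec v v).det :=
    (isUnit_iff_isUnit_det _).mp (hD.add_vecMulVec_self v).isUnit
  have hne : 1 + v ⬝ᵥ D⁻¹ *ᵥ v ≠ 0 := by
    have := hD.dotProduct_inv_mulVec_nonneg v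
    positivity
  have hmul : (D + vecMulVec v v) *ᵥ (D⁻¹ *ᵥ v) = (1 + v ⬝ᵥ D⁻¹ *ᵥ v) • v := by
    rw [add_mulVec, mulVec_mulVec, mul_nonsing_inv _ hdet, one_mulVec, vecMulVec_mulVec,
      op_smul_eq_smul, add_smul, one_smul]
  have hinv : D⁻¹ *ᵥ v = (1 + v ⬝ᵥ D⁻¹ *ᵥ v) • ((D + vecMulVec v v)⁻¹ *ᵥ v) := by
    rw [← mulVec_smul, ← hmul, mulVec_mulVec, nonsing_inv_mul _ hdet', one_mulVec]
  rw [eq_div_iff hne, mul_comm, ← smul_eq_mul, ← dotProduct_smul, ← hinv]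

theorem dotProduct_mul_vecMulVec_mul_mulVec (A : Matrix m m ℝ) (B : Matrix n n ℝ)
    (v : m → ℝ) (u : n → ℝ) :
    v ⬝ᵥ (A * vecMulVec v u * B) *ᵥ u = (v ⬝ᵥ A *ᵥ v) * (u ⬝ᵥ B *ᵥ u) := by
  rw [← mulVec_mulVec, ← mulVec_mulVec, vecMulVec_mulVec, op_smul_eq_smul, mulVec_smul,
    dotProduct_smul, smul_eq_mul, mul_comm]

end Matrix

/-- with `Σ_X = D_X + v vᵀ`, `Σ_Y = D_Y + u uᵀ`,
`Σ_{XY} = ρ v uᵀ`, `h_X = vᵀ D_X⁻¹ v` and `h_Y = uᵀ D_Y⁻¹ u`, the normalized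
cross term satisfies
`(vᵀ Σ_X⁻¹ v)^{-1/2} (uᵀ Σ_Y⁻¹ u)^{-1/2} vᵀ Σ_X⁻¹ Σ_{XY} Σ_Y⁻¹ u
  = √((h_X/(1+h_X)) (h_Y/(1+h_Y))) ρ`. -/
theorem stmt13 {p r : ℕ}
    (DX : Matrix (Fin p) (Fin p) ℝ) (DY : Matrix (Fin r) (Fin r) ℝ)
    (hDX : DX.PosDef) (hDY : DY.PosDef)
    (v : Fin p → ℝ) (u : Fin r → ℝ) (hv : v ≠ 0) (hu : u ≠ 0) (ρ : ℝ)
    (SX : Matrix (Fin p) (Fin p) ℝ) (SY : Matrix (Fin r) (Fin r) ℝ)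
    (SXY : Matrix (Fin p) (Fin r) ℝ)
    (hSX : SX = DX + vecMulVec v v) (hSY : SY = DY + vecMulVec u u)
    (hSXY : SXY = ρ • vecMulVec v u) :
    (Real.sqrt (v ⬝ᵥ SX⁻¹ *ᵥ v))⁻¹ * (Real.sqrt (u ⬝ᵥ SY⁻¹ *ᵥ u))⁻¹ *
        (v ⬝ᵥ (SX⁻¹ * SXY * SY⁻¹) *ᵥ u) =
      Real.sqrt (((v ⬝ᵥ DX⁻¹ *ᵥ v) / (1 + v ⬝ᵥ DX⁻¹ *ᵥ v)) *
          ((u ⬝ᵥ DY⁻¹ *ᵥ u) / (1 + u ⬝ᵥ DY⁻¹ *ᵥ u))) * ρ := by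
  subst hSX hSY hSXY
  have hX := (hDX.add_vecMulVec_self v).dotProduct_inv_mulVec_nonneg v
  rw [Matrix.mul_smul, Matrix.smul_mul, smul_mulVec, dotProduct_smul, smul_eq_mul,
    dotProduct_mul_vecMulVec_mul_mulVec, ← hDX.dotProduct_inv_add_vecMulVec_mulVec,
    ← hDY.dotProduct_inv_add_vecMulVec_mulVec, Real.sqrt_mul hX]
  generalize v ⬝ᵥ (DX + vecMulVec v v)⁻¹ *ᵥ v = a
  generalize u ⬝ᵥ (DY + vecMulVec u u)⁻¹ *ᵥ u = b
  calc (√a)⁻¹ * (√b)⁻¹ * (ρ * (a * b)) = a / √a * (b / √b) * ρ := by ring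
    _ = √a * √b * ρ := by rw [Real.div_sqrt, Real.div_sqrt]
end

section
/- Let (Gamma, Gamma_0) be an orthogonal r-by-r real matrix with Gamma r-by-u, and (Phi, Phi_0) an orthogonal p-by-p real matrix with Phi p-by-q. Suppose Sigma_Y = Gamma M Gamma^T + Gamma_0 Omega_0 Gamma_0^T with M (u-by-u) and Omega_0 positive definite, Sigma_X = Phi N Phi^T + Phi_0 Delta_0 Phi_0^T with N (q-by-q) and Delta_0 positive definite, and Sigma_{YX} = Gamma C Phi^T for some u-by-q matrix C. Then trace(Sigma_{YX}^T Sigma_Y^{-1} Sigma_{YX} Sigma_X^{-1}) = trace( (Gamma^T Sigma_{YX} Phi)^T (Gamma^T Sigma_Y Gamma)^{-1} (Gamma^T Sigma_{YX} Phi) (Phi^T Sigma_X Phi)^{-1} ). -/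
open Matrix

section BlockDiagonal

variable {R n k l : Type*} [CommRing R] [Fintype n] [Fintype k] [Fintype l]

theorem Matrix.transpose_mul_blockSum_mul [DecidableEq k] {G : Matrix n k R} {H : Matrix n l R}
    (hG : Gᵀ * G = 1) (hGH : Gᵀ * H = 0) (A : Matrix k k R) (B : Matrix l l R) :
    Gᵀ * (G * A * Gᵀ + H * B * Hᵀ) * G = A := by
  calc Gᵀ * (G * A * Gᵀ + H * B * Hᵀ) * G
      = (Gᵀ * G) * A * (Gᵀ * G) + (Gᵀ * H) * B * (Hᵀ * G) := by
        simp only [Matrix.mul_add, Matrix.add_mul, Matrix.mul_assoc]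
    _ = A := by simp [hG, hGH]

theorem Matrix.inv_blockSum [DecidableEq n] [DecidableEq k] [DecidableEq l]
    {G : Matrix n k R} {H : Matrix n l R}
    (hG : Gᵀ * G = 1) (hH : Hᵀ * H = 1) (hGH : Gᵀ * H = 0) (hsum : G * Gᵀ + H * Hᵀ = 1)
    {A : Matrix k k R} {B : Matrix l l R} (hA : IsUnit A.det) (hB : IsUnit B.det) :
    (G * A * Gᵀ + H * B * Hᵀ)⁻¹ = G * A⁻¹ * Gᵀ + H * B⁻¹ * Hᵀ := by
  have hHG : Hᵀ * G = 0 := by simpa using congrArg transpose hGH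
  apply Matrix.inv_eq_right_inv
  calc (G * A * Gᵀ + H * B * Hᵀ) * (G * A⁻¹ * Gᵀ + H * B⁻¹ * Hᵀ)
      = G * A * (Gᵀ * G) * A⁻¹ * Gᵀ + G * A * (Gᵀ * H) * B⁻¹ * Hᵀ
        + (H * B * (Hᵀ * G) * A⁻¹ * Gᵀ + H * B * (Hᵀ * H) * B⁻¹ * Hᵀ) := by
        simp only [Matrix.mul_add, Matrix.add_mul, Matrix.mul_assoc]
        abel
    _ = G * (A * A⁻¹) * Gᵀ + H * (B * B⁻¹) * Hᵀ := by
        simp only [hG, hH, hGH, hHG, Matrix.mul_one, Matrix.mul_zero, Matrix.zero_mul, add_zero,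
          zero_add, Matrix.mul_assoc]
    _ = 1 := by
        rw [Matrix.mul_nonsing_inv _ hA, Matrix.mul_nonsing_inv _ hB, Matrix.mul_one,
          Matrix.mul_one, hsum]

end BlockDiagonal

/-- under the envelope structure
`Σ_Y = Γ M Γᵀ + Γ₀ Ω₀ Γ₀ᵀ`, `Σ_X = Φ N Φᵀ + Φ₀ Δ₀ Φ₀ᵀ` and
`Σ_{YX} = Γ C Φᵀ`, with `(Γ, Γ₀)` and `(Φ, Φ₀)` orthogonal and
`M, Ω₀, N, Δ₀` positive definite, one has
`tr(Σ_{YX}ᵀ Σ_Y⁻¹ Σ_{YX} Σ_X⁻¹)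
  = tr((Γᵀ Σ_{YX} Φ)ᵀ (Γᵀ Σ_Y Γ)⁻¹ (Γᵀ Σ_{YX} Φ) (Φᵀ Σ_X Φ)⁻¹)`,
i.e. the envelope composites `Γᵀ Y` and `Φᵀ X` carry all the association. -/
theorem stmt16 {r u u0 p q q0 : ℕ}
    (Γ : Matrix (Fin r) (Fin u) ℝ) (Γ0 : Matrix (Fin r) (Fin u0) ℝ)
    (Φ : Matrix (Fin p) (Fin q) ℝ) (Φ0 : Matrix (Fin p) (Fin q0) ℝ)
    (hΓ1 : Γᵀ * Γ = 1) (hΓ2 : Γ0ᵀ * Γ0 = 1) (hΓ3 : Γᵀ * Γ0 = 0)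
    (hΓ4 : Γ * Γᵀ + Γ0 * Γ0ᵀ = 1)
    (hΦ1 : Φᵀ * Φ = 1) (hΦ2 : Φ0ᵀ * Φ0 = 1) (hΦ3 : Φᵀ * Φ0 = 0)
    (hΦ4 : Φ * Φᵀ + Φ0 * Φ0ᵀ = 1)
    (M : Matrix (Fin u) (Fin u) ℝ) (Ω0 : Matrix (Fin u0) (Fin u0) ℝ)
    (N : Matrix (Fin q) (Fin q) ℝ) (Δ0 : Matrix (Fin q0) (Fin q0) ℝ)
    (hM : M.PosDef) (hΩ0 : Ω0.PosDef) (hN : N.PosDef) (hΔ0 : Δ0.PosDef)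
    (C : Matrix (Fin u) (Fin q) ℝ)
    (SY : Matrix (Fin r) (Fin r) ℝ) (SX : Matrix (Fin p) (Fin p) ℝ)
    (SYX : Matrix (Fin r) (Fin p) ℝ)
    (hSY : SY = Γ * M * Γᵀ + Γ0 * Ω0 * Γ0ᵀ)
    (hSX : SX = Φ * N * Φᵀ + Φ0 * Δ0 * Φ0ᵀ)
    (hSYX : SYX = Γ * C * Φᵀ) :
    (SYXᵀ * SY⁻¹ * SYX * SX⁻¹).trace =
      ((Γᵀ * SYX * Φ)ᵀ * (Γᵀ * SY * Γ)⁻¹ *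
        (Γᵀ * SYX * Φ) * (Φᵀ * SX * Φ)⁻¹).trace := by
  have hSYinv : Γᵀ * SY⁻¹ * Γ = M⁻¹ := by
    rw [hSY, inv_blockSum hΓ1 hΓ2 hΓ3 hΓ4 hM.det_pos.ne'.isUnit hΩ0.det_pos.ne'.isUnit,
      transpose_mul_blockSum_mul hΓ1 hΓ3]
  have hSXinv : Φᵀ * SX⁻¹ * Φ = N⁻¹ := by
    rw [hSX, inv_blockSum hΦ1 hΦ2 hΦ3 hΦ4 hN.det_pos.ne'.isUnit hΔ0.det_pos.ne'.isUnit,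
      transpose_mul_blockSum_mul hΦ1 hΦ3]
  have hSY' : Γᵀ * SY * Γ = M := by rw [hSY, transpose_mul_blockSum_mul hΓ1 hΓ3]
  have hSX' : Φᵀ * SX * Φ = N := by rw [hSX, transpose_mul_blockSum_mul hΦ1 hΦ3]
  have hC : Γᵀ * SYX * Φ = C := by
    calc Γᵀ * SYX * Φ = (Γᵀ * Γ) * C * (Φᵀ * Φ) := by simp only [hSYX, Matrix.mul_assoc]
      _ = C := by rw [hΓ1, hΦ1, Matrix.one_mul, Matrix.mul_one]
  rw [hSY', hSX', hC, ← hSYinv, ← hSXinv]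
  calc (SYXᵀ * SY⁻¹ * SYX * SX⁻¹).trace
      = (Φ * (Cᵀ * (Γᵀ * SY⁻¹ * Γ) * C * Φᵀ * SX⁻¹)).trace := by
        simp only [hSYX, transpose_mul, transpose_transpose, Matrix.mul_assoc]
    _ = (Cᵀ * (Γᵀ * SY⁻¹ * Γ) * C * (Φᵀ * SX⁻¹ * Φ)).trace := by
        rw [trace_mul_comm]
        simp only [Matrix.mul_assoc]
end
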